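/- Suppose |c₁/(𝓜·exp(−0.5)) − 1| ≥ |c₁/(𝔐·exp(−0.5)) − 1|. Then for any V̄ ∈ ℝ^{m×c₁} and Ṽ ∈ ℝ^{m×c₂}: ‖exp(Q̄)exp(K̄)ᵀ − exp(Q̄K̄ᵀ) ⊙ exp(Q̃K̃ᵀ)‖_F · ‖V̄‖_F + ‖exp(Q̃K̃ᵀ) ⊙ Z − exp(Q̄K̄ᵀ) ⊙ exp(Q̃K̃ᵀ)‖_F · ‖Ṽ‖_F ≤ ((c₁/(𝓜·exp(−0.5))) · ‖U_m − exp(Q̃K̃ᵀ)‖_F + |c₁/(𝓜·exp(−0.5)) − 1| · ‖exp(Q̃K̃ᵀ)‖_F) · ‖exp(Q̄K̄ᵀ)‖_F · ‖V̄‖_F + ‖Z − exp(Q̄K̄ᵀ)‖_F · ‖exp(Q̃K̃ᵀ)‖_F · ‖Ṽ‖_F. -/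

import Mathlib

open Matrix Finset

/-- Entrywise exponential of a real matrix. -/
noncomputable def eexp {α β : Type*} (A : Matrix α β ℝ) : Matrix α β ℝ := A.map Real.exp

/-- Frobenius norm of a real matrix. -/
noncomputable def frob {α β : Type*} [Fintype α] [Fintype β] (A : Matrix α β ℝ) : ℝ :=
  Real.sqrt (∑ i, ∑ j, (A i j) ^ 2)

/-- The all-ones square matrix. -/
def allOnes (α : Type*) : Matrix α α ℝ := Matrix.of fun _ _ => 1

/-- 𝔐: the maximum of exp(⟨q̄ᵢ₁, k̄ᵢ₂⟩ + 0.5 − (q̄ᵢ₁ⱼ + k̄ᵢ₂ⱼ)). -/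
noncomputable def bigM {ι : Type*} [Fintype ι] [Nonempty ι] {c₁ : ℕ} [NeZero c₁]
    (Q K : Matrix ι (Fin c₁) ℝ) : ℝ :=
  Finset.univ.sup' Finset.univ_nonempty fun p : ι × ι × Fin c₁ =>
    Real.exp ((∑ j, Q p.1 j * K p.2.1 j) + 0.5 - (Q p.1 p.2.2 + K p.2.1 p.2.2))

/-- 𝓜: the minimum of exp(⟨q̄ᵢ₁, k̄ᵢ₂⟩ + 0.5 − (q̄ᵢ₁ⱼ + k̄ᵢ₂ⱼ)). -/
noncomputable def smallM {ι : Type*} [Fintype ι] [Nonempty ι] {c₁ : ℕ} [NeZero c₁]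
    (Q K : Matrix ι (Fin c₁) ℝ) : ℝ :=
  Finset.univ.inf' Finset.univ_nonempty fun p : ι × ι × Fin c₁ =>
    Real.exp ((∑ j, Q p.1 j * K p.2.1 j) + 0.5 - (Q p.1 p.2.2 + K p.2.1 p.2.2))

/-- Z = I_b ⊗ U_p : the block-diagonal 0/1 mask with b diagonal all-ones p×p blocks. -/
def blockZ (b p : ℕ) : Matrix (Fin b × Fin p) (Fin b × Fin p) ℝ :=
  Matrix.kroneckerMap (· * ·) (1 : Matrix (Fin b) (Fin b) ℝ) (allOnes (Fin p))

section Frobenius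

variable {α β : Type*} [Fintype α] [Fintype β]

lemma frob_nonneg (A : Matrix α β ℝ) : 0 ≤ frob A := Real.sqrt_nonneg _

lemma frob_le_frob_of_abs_le {A B : Matrix α β ℝ} (h : ∀ i j, |A i j| ≤ B i j) :
    frob A ≤ frob B :=
  Real.sqrt_le_sqrt <| sum_le_sum fun i _ => sum_le_sum fun j _ =>
    sq_le_sq.mpr ((h i j).trans (le_abs_self _))

lemma frob_abs (A : Matrix α β ℝ) : frob (A.map abs) = frob A := by
  simp [frob]

lemma frob_smul (c : ℝ) (A : Matrix α β ℝ) : frob (c • A) = |c| * frob A := by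
  simp only [frob, Matrix.smul_apply, smul_eq_mul, mul_pow, ← mul_sum]
  rw [Real.sqrt_mul (sq_nonneg c), Real.sqrt_sq_eq_abs]

lemma frob_add_le (A B : Matrix α β ℝ) : frob (A + B) ≤ frob A + frob B := by
  let := Matrix.frobeniusNormedAddCommGroup (m := α) (n := β) (α := ℝ)
  have key : ∀ C : Matrix α β ℝ, frob C = ‖C‖ := fun C => by
    rw [Matrix.frobenius_norm_def, frob, Real.sqrt_eq_rpow]
    simp
  simpa only [key] using norm_add_le A B

lemma frob_hadamard_le (A B : Matrix α β ℝ) : frob (A.hadamard B) ≤ frob A * frob B := by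
  have h0 : 0 ≤ ∑ i, ∑ j, A i j ^ 2 := by positivity
  rw [frob, frob, frob, ← Real.sqrt_mul h0]
  refine Real.sqrt_le_sqrt ?_
  simp only [mul_sum]
  refine sum_le_sum fun i _ => sum_le_sum fun j _ => ?_
  rw [Matrix.hadamard_apply, mul_pow]
  gcongr
  exact (single_le_sum (f := fun j => A i j ^ 2) (fun _ _ => sq_nonneg _) (mem_univ j)).trans
    (single_le_sum (f := fun i => ∑ j, A i j ^ 2) (fun _ _ => by positivity) (mem_univ i))

end Frobenius

section ExpProduct

lemma eexp_mul_transpose_apply {α β : Type*} [Fintype β] (Q K : Matrix α β ℝ) (i k : α) :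
    (eexp Q * (eexp K)ᵀ) i k = ∑ j, Real.exp (Q i j + K k j) := by
  simp [eexp, Matrix.mul_apply, Real.exp_add]

variable {ι : Type*} [Fintype ι] [Nonempty ι] {c₁ : ℕ} [NeZero c₁]

lemma smallM_pos (Q K : Matrix ι (Fin c₁) ℝ) : 0 < smallM Q K :=
  (Finset.lt_inf'_iff _).mpr fun _ _ => Real.exp_pos _

lemma bigM_pos (Q K : Matrix ι (Fin c₁) ℝ) : 0 < bigM Q K :=
  (Finset.lt_sup'_iff _).mpr ⟨Classical.arbitrary _, mem_univ _, Real.exp_pos _⟩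

lemma smallM_le (Q K : Matrix ι (Fin c₁) ℝ) (i k : ι) (j : Fin c₁) :
    smallM Q K ≤ Real.exp ((∑ l, Q i l * K k l) + 0.5 - (Q i j + K k j)) :=
  Finset.inf'_le (fun p : ι × ι × Fin c₁ =>
    Real.exp ((∑ l, Q p.1 l * K p.2.1 l) + 0.5 - (Q p.1 p.2.2 + K p.2.1 p.2.2)))
    (mem_univ (i, k, j))

lemma le_bigM (Q K : Matrix ι (Fin c₁) ℝ) (i k : ι) (j : Fin c₁) :
    Real.exp ((∑ l, Q i l * K k l) + 0.5 - (Q i j + K k j)) ≤ bigM Q K :=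
  Finset.le_sup' (fun p : ι × ι × Fin c₁ =>
    Real.exp ((∑ l, Q p.1 l * K p.2.1 l) + 0.5 - (Q p.1 p.2.2 + K p.2.1 p.2.2)))
    (mem_univ (i, k, j))

lemma eexp_mul_transpose_le (Q K : Matrix ι (Fin c₁) ℝ) (i k : ι) :
    (eexp Q * (eexp K)ᵀ) i k ≤
      (c₁ : ℝ) / (smallM Q K * Real.exp (-0.5)) * eexp (Q * Kᵀ) i k := by
  have hpos := mul_pos (smallM_pos Q K) (Real.exp_pos (-0.5))
  rw [eexp_mul_transpose_apply, div_mul_eq_mul_div, mul_div_assoc, ← nsmul_eq_mul]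
  refine (sum_le_card_nsmul univ _ _ fun j _ => ?_).trans_eq (by rw [card_univ, Fintype.card_fin])
  rw [le_div_iff₀ hpos]
  calc Real.exp (Q i j + K k j) * (smallM Q K * Real.exp (-0.5))
      ≤ Real.exp (Q i j + K k j) *
        (Real.exp ((∑ l, Q i l * K k l) + 0.5 - (Q i j + K k j)) * Real.exp (-0.5)) := by
        gcongr
        exact smallM_le Q K i k j
    _ = eexp (Q * Kᵀ) i k := by
        rw [← Real.exp_add, ← Real.exp_add]
        simp only [eexp, Matrix.map_apply, Matrix.mul_apply, Matrix.transpose_apply]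
        ring_nf

lemma le_eexp_mul_transpose (Q K : Matrix ι (Fin c₁) ℝ) (i k : ι) :
    (c₁ : ℝ) / (bigM Q K * Real.exp (-0.5)) * eexp (Q * Kᵀ) i k ≤
      (eexp Q * (eexp K)ᵀ) i k := by
  have hpos := mul_pos (bigM_pos Q K) (Real.exp_pos (-0.5))
  rw [eexp_mul_transpose_apply, div_mul_eq_mul_div, mul_div_assoc, ← nsmul_eq_mul]
  refine Eq.trans_le (by rw [card_univ, Fintype.card_fin])
    (card_nsmul_le_sum univ _ _ fun j _ => ?_)
  rw [div_le_iff₀ hpos]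
  calc eexp (Q * Kᵀ) i k = Real.exp (Q i j + K k j) *
        (Real.exp ((∑ l, Q i l * K k l) + 0.5 - (Q i j + K k j)) * Real.exp (-0.5)) := by
        rw [← Real.exp_add, ← Real.exp_add]
        simp only [eexp, Matrix.map_apply, Matrix.mul_apply, Matrix.transpose_apply]
        ring_nf
    _ ≤ Real.exp (Q i j + K k j) * (bigM Q K * Real.exp (-0.5)) := by
        gcongr
        exact le_bigM Q K i k j

end ExpProduct

/-- If `x / s` lies in `[a', a]` and `a` is at least as far from `1` as `a'`, then `x` differs
from `s * t` by at most `s * (a * |1 - t| + |a - 1| * t)`. -/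
lemma abs_sub_mul_le {x s t a a' : ℝ} (hs : 0 < s) (ht : 0 ≤ t) (hx : 0 ≤ x)
    (hxa : x ≤ a * s) (hax : a' * s ≤ x) (h : |a' - 1| ≤ |a - 1|) :
    |x - s * t| ≤ s * (a * |1 - t| + |a - 1| * t) := by
  obtain ⟨r, rfl⟩ : ∃ r, x = r * s := ⟨x / s, by field_simp⟩
  have hra : r ≤ a := le_of_mul_le_mul_right hxa hs
  have har : a' ≤ r := le_of_mul_le_mul_right hax hs
  have hr : 0 ≤ r := nonneg_of_mul_nonneg_left hx hs
  have hr1 : |r - 1| ≤ |a - 1| :=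
    (abs_le_max_abs_abs (sub_le_sub_right har 1) (sub_le_sub_right hra 1)).trans (max_le h le_rfl)
  calc |r * s - s * t| = s * |r * (1 - t) + (r - 1) * t| := by
        rw [← abs_of_pos hs, ← abs_mul, abs_of_pos hs]
        ring_nf
    _ ≤ s * (|r * (1 - t)| + |(r - 1) * t|) := by
        gcongr
        exact abs_add_le _ _
    _ = s * (r * |1 - t| + |r - 1| * t) := by
        rw [abs_mul, abs_mul, abs_of_nonneg hr, abs_of_nonneg ht]
    _ ≤ s * (a * |1 - t| + |a - 1| * t) := by gcongr

/-- if |c₁/(𝓜e) − 1| ≥ |c₁/(𝔐e) − 1| (with e = exp(−0.5)), then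
‖exp(Q̄)exp(K̄)ᵀ − exp(Q̄K̄ᵀ) ⊙ exp(Q̃K̃ᵀ)‖_F ‖V̄‖_F
+ ‖exp(Q̃K̃ᵀ) ⊙ Z − exp(Q̄K̄ᵀ) ⊙ exp(Q̃K̃ᵀ)‖_F ‖Ṽ‖_F ≤
((c₁/(𝓜e)) ‖U_m − exp(Q̃K̃ᵀ)‖_F + |c₁/(𝓜e) − 1| ‖exp(Q̃K̃ᵀ)‖_F) ‖exp(Q̄K̄ᵀ)‖_F ‖V̄‖_F
+ ‖Z − exp(Q̄K̄ᵀ)‖_F ‖exp(Q̃K̃ᵀ)‖_F ‖Ṽ‖_F. -/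
theorem stmt_12 (b p c₁ c₂ : ℕ) [NeZero b] [NeZero p] [NeZero c₁] [NeZero c₂]
    (Qb Kb : Matrix (Fin b × Fin p) (Fin c₁) ℝ)
    (Qt Kt : Matrix (Fin b × Fin p) (Fin c₂) ℝ)
    (h : |(c₁ : ℝ) / (smallM Qb Kb * Real.exp (-0.5)) - 1| ≥
        |(c₁ : ℝ) / (bigM Qb Kb * Real.exp (-0.5)) - 1|)
    (Vb : Matrix (Fin b × Fin p) (Fin c₁) ℝ) (Vt : Matrix (Fin b × Fin p) (Fin c₂) ℝ) :
    frob (eexp Qb * (eexp Kb)ᵀ - (eexp (Qb * Kbᵀ)).hadamard (eexp (Qt * Ktᵀ))) * frob Vb +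
        frob ((eexp (Qt * Ktᵀ)).hadamard (blockZ b p) -
            (eexp (Qb * Kbᵀ)).hadamard (eexp (Qt * Ktᵀ))) * frob Vt ≤
      ((c₁ : ℝ) / (smallM Qb Kb * Real.exp (-0.5)) *
            frob (allOnes (Fin b × Fin p) - eexp (Qt * Ktᵀ)) +
          |(c₁ : ℝ) / (smallM Qb Kb * Real.exp (-0.5)) - 1| * frob (eexp (Qt * Ktᵀ))) *
          frob (eexp (Qb * Kbᵀ)) * frob Vb +
        frob (blockZ b p - eexp (Qb * Kbᵀ)) * frob (eexp (Qt * Ktᵀ)) * frob Vt := by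
  set S := eexp (Qb * Kbᵀ)
  set T := eexp (Qt * Ktᵀ)
  set a := (c₁ : ℝ) / (smallM Qb Kb * Real.exp (-0.5))
  have ha : 0 ≤ a := div_nonneg c₁.cast_nonneg
    (mul_pos (smallM_pos Qb Kb) (Real.exp_pos _)).le
  have hfirst : frob (eexp Qb * (eexp Kb)ᵀ - S.hadamard T) ≤
      (a * frob (allOnes (Fin b × Fin p) - T) + |a - 1| * frob T) * frob S := by
    calc frob (eexp Qb * (eexp Kb)ᵀ - S.hadamard T)
        ≤ frob (S.hadamard (a • (allOnes (Fin b × Fin p) - T).map abs + |a - 1| • T)) :=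
          frob_le_frob_of_abs_le fun i k =>
            abs_sub_mul_le (Real.exp_pos _) (Real.exp_pos _).le
              (by rw [eexp_mul_transpose_apply]; positivity)
              (eexp_mul_transpose_le Qb Kb i k) (le_eexp_mul_transpose Qb Kb i k) h
      _ ≤ frob S * (frob (a • (allOnes (Fin b × Fin p) - T).map abs) + frob (|a - 1| • T)) :=
          (frob_hadamard_le _ _).trans
            (mul_le_mul_of_nonneg_left (frob_add_le _ _) (frob_nonneg _))
      _ = (a * frob (allOnes (Fin b × Fin p) - T) + |a - 1| * frob T) * frob S := by
          rw [frob_smul, frob_smul, frob_abs, abs_abs, abs_of_nonneg ha, mul_comm]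
  have hsecond : frob (T.hadamard (blockZ b p) - S.hadamard T) ≤
      frob (blockZ b p - S) * frob T := by
    have : T.hadamard (blockZ b p) - S.hadamard T = (blockZ b p - S).hadamard T := by
      ext i k
      simp only [Matrix.sub_apply, Matrix.hadamard_apply]
      ring
    exact this ▸ frob_hadamard_le _ _
  exact add_le_add (mul_le_mul_of_nonneg_right hfirst (frob_nonneg _))
    (mul_le_mul_of_nonneg_right hsecond (frob_nonneg _))
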